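/- Let n ≥ 1, let Ω ⊆ 𝕆_sⁿ be a real-connected slice-domain, and let f, g : Ω → 𝕆 be weak slice regular. Suppose that either there exist I ∈ 𝕊 and a nonempty set A ⊆ Ω ∩ ℂ_Iⁿ that is open in ℂ_Iⁿ with f = g on A, or there exists a nonempty set A ⊆ Ω ∩ ℝⁿ that is open in ℝⁿ with f = g on A. Then f = g on all of Ω. -/

import Mathlib

/-! Octonions via the Cayley–Dickson construction on the quaternions,
the n-dimensional quadratic cone, the slice topology, and slice regularity. -/

noncomputable section
open Quaternion Topology

/-- The octonions, as `ℍ × ℍ` with the (L²) Euclidean norm and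
Cayley–Dickson multiplication. -/
abbrev Oct : Type := WithLp 2 (ℍ × ℍ)

namespace Oct

def c1 (p : Oct) : ℍ := (WithLp.equiv 2 (ℍ × ℍ) p).1
def c2 (p : Oct) : ℍ := (WithLp.equiv 2 (ℍ × ℍ) p).2
def mk (a b : ℍ) : Oct := (WithLp.equiv 2 (ℍ × ℍ)).symm (a, b)

instance : One Oct := ⟨mk 1 0⟩

/-- Cayley–Dickson multiplication. -/
instance : Mul Oct :=
  ⟨fun p q => mk (c1 p * c1 q - star (c2 q) * c2 p) (c2 q * c1 p + c2 p * star (c1 q))⟩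

/-- Octonionic conjugation. -/
instance : Star Oct := ⟨fun p => mk (star (c1 p)) (-(c2 p))⟩

/-- Inverse: `p⁻¹ = ‖p‖⁻² • (star p)` (so `0⁻¹ = 0`). -/
instance : Inv Oct := ⟨fun p => (‖p‖ ^ 2)⁻¹ • star p⟩

/-- The real inner product on `𝕆 ≅ ℝ⁸`, via polarization. -/
def oinner (p q : Oct) : ℝ := (1 / 4) * (‖p + q‖ ^ 2 - ‖p - q‖ ^ 2)

/-- The sphere `𝕊` of imaginary units of the octonions. -/
def Sph : Set Oct := {I | I * I = -1}

/-- The slice complex plane `ℂ_I = ℝ + ℝ I ⊆ 𝕆`. -/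
def CI (I : Oct) : Set Oct := {z | ∃ s t : ℝ, z = s • (1 : Oct) + t • I}

end Oct

open Oct

/-- The point `x + y I ∈ ℂ_Iⁿ ⊆ 𝕆ⁿ`. -/
def aff {n : ℕ} (x y : Fin n → ℝ) (I : Oct) : Fin n → Oct :=
  fun m => x m • (1 : Oct) + y m • I

/-- The embedding `ℝⁿ ⊆ 𝕆ⁿ`. -/
def ofRealn {n : ℕ} (x : Fin n → ℝ) : Fin n → Oct := fun m => x m • (1 : Oct)

/-- The slice `ℂ_Iⁿ ⊆ 𝕆ⁿ`. -/
def slicen (n : ℕ) (I : Oct) : Set (Fin n → Oct) := {q | ∃ x y : Fin n → ℝ, q = aff x y I}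

/-- The `n`-dimensional quadratic cone `𝕆ₛⁿ = ⋃_{I ∈ 𝕊} ℂ_Iⁿ`. -/
def cone (n : ℕ) : Set (Fin n → Oct) := ⋃ I ∈ Sph, slicen n I

/-- The slice topology `τ_s`: a set is open iff its trace on every slice `ℂ_Iⁿ`
is open (expressed via the canonical parametrizations `(x,y) ↦ x + yI`). -/
def τs (n : ℕ) : TopologicalSpace (Fin n → Oct) :=
  ⨆ I : Sph, TopologicalSpace.coinduced
    (fun p : (Fin n → ℝ) × (Fin n → ℝ) => aff p.1 p.2 I.1) inferInstance

/-- A slice-open subset of the quadratic cone. -/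
def SliceOpen (n : ℕ) (Ω : Set (Fin n → Oct)) : Prop :=
  Ω ⊆ cone n ∧ IsOpen[τs n] Ω

/-- A slice-domain: a nonempty slice-connected slice-open subset of the cone. -/
def SliceDomain (n : ℕ) (Ω : Set (Fin n → Oct)) : Prop :=
  SliceOpen n Ω ∧ @IsConnected _ (τs n) Ω

/-- Real-connectedness: `Ω ∩ ℝⁿ` is a (pre)connected subset of `ℝⁿ`. -/
def RealConnected (n : ℕ) (Ω : Set (Fin n → Oct)) : Prop :=
  IsPreconnected {x : Fin n → ℝ | ofRealn x ∈ Ω}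

/-- Axially symmetric subsets of the cone. -/
def AxSymm (n : ℕ) (Ω : Set (Fin n → Oct)) : Prop :=
  ∀ (x y : Fin n → ℝ), ∀ I ∈ Sph, ∀ J ∈ Sph, aff x y I ∈ Ω → aff x y J ∈ Ω

/-- The upper half-space `ℝ²ⁿ₊`: pairs `(x,y)` with `y = 0` or the first
nonzero coordinate of `y` positive. -/
def pos2n (n : ℕ) : Set ((Fin n → ℝ) × (Fin n → ℝ)) :=
  {p | p.2 = 0 ∨ ∃ m : Fin n, 0 < p.2 m ∧ ∀ k : Fin n, k < m → p.2 k = 0}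

/-- `Ω_{s₁}`. -/
def s1 {n : ℕ} (Ω : Set (Fin n → Oct)) : Set ((Fin n → ℝ) × (Fin n → ℝ)) :=
  {p | ∃ I ∈ Sph, aff p.1 p.2 I ∈ Ω}

/-- `Ω_{s₂}`. -/
def s2 {n : ℕ} (Ω : Set (Fin n → Oct)) : Set ((Fin n → ℝ) × (Fin n → ℝ)) :=
  {p | ∃ J ∈ Sph, ∃ K ∈ Sph, J ≠ K ∧ aff p.1 p.2 J ∈ Ω ∧ aff p.1 p.2 K ∈ Ω}

/-- Slice functions: induced on `Ω_{s₂}⁺` by a pair `(F₁, F₂)` via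
`f(x + yI) = F₁(x,y) + I·F₂(x,y)`. -/
def IsSliceFun (n : ℕ) (Ω : Set (Fin n → Oct)) (f : (Fin n → Oct) → Oct) : Prop :=
  ∃ F₁ F₂ : (Fin n → ℝ) × (Fin n → ℝ) → Oct,
    ∀ x y : Fin n → ℝ, (x, y) ∈ s2 Ω ∩ pos2n n → ∀ I ∈ Sph, aff x y I ∈ Ω →
      f (aff x y I) = F₁ (x, y) + I * F₂ (x, y)

/-- Holomorphy of a function of `n` slice variables, read through the
parametrization `(x,y) ↦ x + yI`: continuous partial derivatives (i.e. `C¹`)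
and the Cauchy–Riemann equations `(∂/∂xₘ + I ∂/∂yₘ) g = 0` on `U`. -/
def Holo (n : ℕ) (I : Oct) (g : (Fin n → ℝ) × (Fin n → ℝ) → Oct)
    (U : Set ((Fin n → ℝ) × (Fin n → ℝ))) : Prop :=
  ContDiffOn ℝ 1 g U ∧
  ∀ p ∈ U, ∀ m : Fin n,
    fderiv ℝ g p (Pi.single m 1, 0) + I * fderiv ℝ g p (0, Pi.single m 1) = 0

/-- Weak slice regularity: each restriction `f|_{Ω ∩ ℂ_Iⁿ}` is holomorphic. -/
def WSliceReg (n : ℕ) (Ω : Set (Fin n → Oct)) (f : (Fin n → Oct) → Oct) : Prop :=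
  ∀ I ∈ Sph, Holo n I (fun p => f (aff p.1 p.2 I)) {p | aff p.1 p.2 I ∈ Ω}

/-- The complex structure `σ(a,b) = (−b,a)` on `𝕆²`. -/
def sigma2 : Oct × Oct → Oct × Oct := fun w => (-w.2, w.1)

/-- Holomorphic stem maps: `F : V → 𝕆²` extends to a `C¹` map `G` on an open
neighborhood `U ⊇ V` satisfying `(∂/∂xₘ + σ ∂/∂yₘ) G = 0` on `U`. -/
def StemHolo (n : ℕ) (V : Set ((Fin n → ℝ) × (Fin n → ℝ)))
    (F : (Fin n → ℝ) × (Fin n → ℝ) → Oct × Oct) : Prop :=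
  ∃ (U : Set ((Fin n → ℝ) × (Fin n → ℝ))) (G : (Fin n → ℝ) × (Fin n → ℝ) → Oct × Oct),
    IsOpen U ∧ V ⊆ U ∧ Set.EqOn G F V ∧ ContDiffOn ℝ 1 G U ∧
    ∀ p ∈ U, ∀ m : Fin n,
      fderiv ℝ G p (Pi.single m 1, 0) + sigma2 (fderiv ℝ G p (0, Pi.single m 1)) = 0

/-- Strong slice regularity: `f` is induced by a holomorphic stem map on `Ω_{s₁}`. -/
def SSliceReg (n : ℕ) (Ω : Set (Fin n → Oct)) (f : (Fin n → Oct) → Oct) : Prop :=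
  ∃ F : (Fin n → ℝ) × (Fin n → ℝ) → Oct × Oct, StemHolo n (s1 Ω) F ∧
    ∀ x y : Fin n → ℝ, ∀ I ∈ Sph, aff x y I ∈ Ω →
      f (aff x y I) = (F (x, y)).1 + I * (F (x, y)).2

/-- An s-basis `{I, J, K}` of the octonions. -/
def IsSBasis (I J K : Oct) : Prop :=
  I ∈ Sph ∧ J ∈ Sph ∧ K ∈ Sph ∧
  LinearIndependent ℝ ![(1 : Oct), I, J, I * J, K, J * K, I * K, (I * J) * K] ∧
  Submodule.span ℝ (Set.range ![(1 : Oct), I, J, I * J, K, J * K, I * K, (I * J) * K]) = ⊤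

/-- Iterated left multiplication `L_w^β = (L_{w₁})^{β₁} ∘ ⋯ ∘ (L_{wₙ})^{βₙ}`. -/
def Lpow {n : ℕ} (w : Fin n → Oct) (β : Fin n → ℕ) : Oct → Oct :=
  fun a => (List.finRange n).foldr (fun ℓ c => (fun o => w ℓ * o)^[β ℓ] c) a

/-- The `*`-power `(q − p)^{*α} a = ∑_{β ≤ α} C(α,β) L_q^β (L_{−p}^{α−β} a)`. -/
def starPow {n : ℕ} (p : Fin n → Oct) (α : Fin n → ℕ) (a : Oct) (q : Fin n → Oct) : Oct :=
  ∑ β ∈ Finset.Iic α, (∏ ℓ, (α ℓ).choose (β ℓ)) • Lpow q β (Lpow (-p) (α - β) a)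

/-- The `ℓ`-th slice derivative `∂_ℓ f (x + w) = (∂/∂x_ℓ) f (x + w)`. -/
def sderiv {n : ℕ} (ℓ : Fin n) (f : (Fin n → Oct) → Oct) : (Fin n → Oct) → Oct :=
  fun q => deriv (fun t : ℝ => f (fun m => q m + (if m = ℓ then t else 0) • (1 : Oct))) 0

/-- The iterated slice derivative `f^{(α)} = (∂₁)^{α₁} ⋯ (∂ₙ)^{αₙ} f`. -/
def sderivMulti {n : ℕ} (α : Fin n → ℕ) (f : (Fin n → Oct) → Oct) : (Fin n → Oct) → Oct :=
  (List.finRange n).foldr (fun ℓ g => (sderiv ℓ)^[α ℓ] g) f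

/-- The slice-polydisc `P̃(q₀, r)` (relative to `I ∈ 𝕊` with `q₀ ∈ ℂ_Iⁿ`):
points `x + yJ` with `x ± yI` in the closed polydisc `P_I(q₀, r)`. -/
def polyDisc {n : ℕ} (q₀ : Fin n → Oct) (I : Oct) (r : Fin n → ℝ) : Set (Fin n → Oct) :=
  {q | ∃ x y : Fin n → ℝ, ∃ J ∈ Sph, q = aff x y J ∧
        (∀ ℓ, ‖aff x y I ℓ - q₀ ℓ‖ ≤ r ℓ) ∧ (∀ ℓ, ‖aff x (-y) I ℓ - q₀ ℓ‖ ≤ r ℓ)}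

open Filter

section ComplexLines

variable {E F : Type*} [NormedAddCommGroup E] [NormedSpace ℝ E]
  [NormedAddCommGroup F] [NormedSpace ℝ F]

/-- Complex scalar multiplication on `E × E`, read as the complexification of `E`. -/
def complexSMul (w : E × E) : ℂ →L[ℝ] E × E :=
  Complex.reCLM.smulRight w + Complex.imCLM.smulRight (-w.2, w.1)

theorem complexSMul_apply (w : E × E) (z : ℂ) :
    complexSMul w z = z.re • w + z.im • (-w.2, w.1) := rfl

/-- `h` satisfies the Cauchy–Riemann equations on `U` for the complex structure `J`. -/
def CROn (J : F →L[ℝ] F) (h : E × E → F) (U : Set (E × E)) : Prop :=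
  ∀ p ∈ U, ∃ D : E × E →L[ℝ] F, HasFDerivAt h D p ∧ ∀ v, D (0, v) = J (D (v, 0))

theorem CROn.mono {J : F →L[ℝ] F} {h : E × E → F} {U V : Set (E × E)}
    (hh : CROn J h V) (hUV : U ⊆ V) : CROn J h U := fun p hp => hh p (hUV hp)

theorem fderiv_complexSMul_of_cauchyRiemann {J : F →L[ℝ] F} (hJ : ∀ x, J (J x) = -x)
    {D : E × E →L[ℝ] F} (hD : ∀ v, D (0, v) = J (D (v, 0))) (w : E × E) (z : ℂ) :
    D (complexSMul w z) = z.re • D w + z.im • J (D w) := by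
  have split (a b : E) : D (a, b) = D (a, 0) + J (D (b, 0)) := by
    rw [← hD, ← map_add]
    simp
  obtain ⟨u, v⟩ := w
  have hrot : D (-v, u) = J (D (u, v)) := by
    have hneg : D (-v, 0) = -D (v, 0) := by
      rw [← map_neg]
      simp
    rw [split (-v) u, split u v, map_add, hJ, hneg, add_comm]
  rw [complexSMul_apply, map_add, map_smul, map_smul, hrot]

theorem CROn.eq_zero_on_complex_line {J : F →L[ℝ] F} (hJ : ∀ x, J (J x) = -x)
    {h : E × E → F} {B : Set (E × E)} (hB : IsOpen B) (hconv : Convex ℝ B)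
    (hh : CROn J h B) {p w : E × E} (hp : p ∈ B)
    (hreal : ∀ᶠ t : ℝ in 𝓝 0, h (p + t • w) = 0) {z : ℂ}
    (hz : p + complexSMul w z ∈ B) : h (p + complexSMul w z) = 0 := by
  refine SeparatingDual.eq_zero_of_forall_dual_eq_zero (R := ℝ) fun l => ?_
  set S : Set ℂ := {z | p + complexSMul w z ∈ B}
  have hS : IsOpen S := hB.preimage (by fun_prop)
  have hSconv : Convex ℝ S := by
    have := (hconv.translate_preimage_right p).linear_preimage (complexSMul w).toLinearMap
    exact this
  set φ : ℂ → ℂ := fun z =>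
    (l (h (p + complexSMul w z)) : ℂ) - Complex.I * (l (J (h (p + complexSMul w z))) : ℂ)
  have hdiff : DifferentiableOn ℂ φ S := by
    intro z hz
    obtain ⟨D, hD, hCR⟩ := hh _ hz
    have hline : HasFDerivAt (fun z : ℂ => p + complexSMul w z) (complexSMul w) z :=
      (complexSMul w).hasFDerivAt.const_add p
    have hcomp := hD.comp z hline
    have h1 := (Complex.ofRealCLM ∘L l).hasFDerivAt.comp z hcomp
    have h2 := (Complex.ofRealCLM ∘L l ∘L J).hasFDerivAt.comp z hcomp
    have hφ := h1.sub (h2.const_mul Complex.I)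
    set c : ℂ := (l (D w) : ℂ) - Complex.I * (l (J (D w)) : ℂ)
    have hderiv : HasFDerivAt φ
        ((ContinuousLinearMap.toSpanSingleton ℂ c).restrictScalars ℝ) z := by
      refine hφ.congr_fderiv ?_
      refine ContinuousLinearMap.ext fun ζ => ?_
      have hζ := fderiv_complexSMul_of_cauchyRiemann hJ hCR w ζ
      simp [hζ, hJ, c]
      linear_combination (-c) * (Complex.re_add_im ζ).symm +
        (ζ.im * l (J (D w)) : ℂ) * Complex.I_sq
    exact (hasFDerivAt_of_restrictScalars ℝ hderiv rfl).differentiableAt.differentiableWithinAt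
  have h0 : (0 : ℂ) ∈ S := by simpa [S] using hp
  have hfreq : ∃ᶠ z in 𝓝[≠] (0 : ℂ), φ z = 0 := by
    have ht : Tendsto (fun t : ℝ => (t : ℂ)) (𝓝[≠] 0) (𝓝[≠] 0) := by
      refine tendsto_nhdsWithin_iff.2 ⟨?_, ?_⟩
      · exact (Complex.continuous_ofReal.tendsto' 0 0 (by simp)).mono_left nhdsWithin_le_nhds
      · filter_upwards [self_mem_nhdsWithin] with t ht
        simpa using ht
    refine ht.frequently (Eventually.frequently ?_)
    filter_upwards [hreal.filter_mono nhdsWithin_le_nhds] with t ht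
    have hline : p + complexSMul w t = p + t • w := by
      rw [complexSMul_apply, Complex.ofReal_re, Complex.ofReal_im, zero_smul, add_zero]
    simp only [φ, hline, ht, map_zero, Complex.ofReal_zero, mul_zero, sub_zero]
  have hzero := (hdiff.analyticOnNhd hS).eqOn_zero_of_preconnected_of_frequently_eq_zero
    hSconv.isPreconnected h0 hfreq hz
  simpa [φ] using congrArg Complex.re hzero

theorem CROn.eqOn_zero_of_eventuallyEq {J : F →L[ℝ] F} (hJ : ∀ x, J (J x) = -x)
    {h : E × E → F} {B : Set (E × E)} (hB : IsOpen B) (hconv : Convex ℝ B)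
    (hh : CROn J h B) {p : E × E} (hp : p ∈ B) (hzero : ∀ᶠ q in 𝓝 p, h q = 0) :
    ∀ q ∈ B, h q = 0 := by
  intro q hq
  have hreal : ∀ᶠ t : ℝ in 𝓝 0, h (p + t • (q - p)) = 0 :=
    (Continuous.tendsto' (by fun_prop) 0 p (by simp)).eventually hzero
  have hline : p + complexSMul (q - p) 1 = q := by simp [complexSMul_apply]
  rw [← hline] at hq ⊢
  exact hh.eq_zero_on_complex_line hJ hB hconv hp hreal hq

theorem CROn.isOpen_not_eventually_zero {J : F →L[ℝ] F} (hJ : ∀ x, J (J x) = -x)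
    {h : E × E → F} {U : Set (E × E)} (hU : IsOpen U) (hh : CROn J h U) :
    IsOpen {p | p ∈ U ∧ ¬ ∀ᶠ q in 𝓝 p, h q = 0} := by
  refine Metric.isOpen_iff.2 fun p ⟨hp, hne⟩ => ?_
  obtain ⟨r, hr, hrU⟩ := Metric.isOpen_iff.1 hU p hp
  refine ⟨r, hr, fun q hq => ⟨hrU hq, fun hzero => hne ?_⟩⟩
  filter_upwards [Metric.ball_mem_nhds p hr] with a ha
  exact (hh.mono hrU).eqOn_zero_of_eventuallyEq hJ Metric.isOpen_ball (convex_ball p r)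
    hq hzero a ha

theorem CROn.eventually_zero_of_real {J : F →L[ℝ] F} (hJ : ∀ x, J (J x) = -x)
    {h : E × E → F} {U : Set (E × E)} (hU : IsOpen U) (hh : CROn J h U) {x : E}
    (hx : (x, 0) ∈ U) (hzero : ∀ᶠ a in 𝓝 x, h (a, 0) = 0) :
    ∀ᶠ q in 𝓝 (x, (0 : E)), h q = 0 := by
  obtain ⟨r, hr, hrU⟩ := Metric.isOpen_iff.1 hU _ hx
  obtain ⟨r', hr', hball⟩ := Metric.eventually_nhds_iff_ball.1 hzero
  have hs : 0 < min r r' := lt_min hr hr'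
  filter_upwards [Metric.ball_mem_nhds (x, (0 : E)) hs] with q hq
  have hsub : Metric.ball (x, (0 : E)) (min r r') ⊆ U :=
    (Metric.ball_subset_ball (min_le_left _ _)).trans hrU
  obtain ⟨a, b⟩ := q
  have ha : a ∈ Metric.ball x (min r r') := by
    rw [← ball_prod_same] at hq
    exact hq.1
  have ha0 : (a, (0 : E)) ∈ Metric.ball (x, (0 : E)) (min r r') := by
    rw [← ball_prod_same]
    exact ⟨ha, Metric.mem_ball_self hs⟩
  have hreal : ∀ᶠ t : ℝ in 𝓝 0, h ((a, 0) + t • (b, (0 : E))) = 0 := by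
    have ht : Tendsto (fun t : ℝ => a + t • b) (𝓝 0) (𝓝 a) :=
      Continuous.tendsto' (by fun_prop) 0 a (by simp)
    filter_upwards [ht.eventually (Metric.isOpen_ball.mem_nhds ha)] with t hta
    simpa using hball _ (Metric.ball_subset_ball (min_le_right _ _) hta)
  have hline : (a, (0 : E)) + complexSMul (b, (0 : E)) Complex.I = (a, b) := by
    simp [complexSMul_apply]
  rw [← hline] at hq ⊢
  exact (hh.mono hsub).eq_zero_on_complex_line hJ Metric.isOpen_ball (convex_ball _ _)
    ha0 hreal hq

end ComplexLines

namespace Oct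

@[ext] theorem ext {p q : Oct} (h1 : c1 p = c1 q) (h2 : c2 p = c2 q) : p = q :=
  (WithLp.equiv 2 (ℍ × ℍ)).injective (Prod.ext h1 h2)

@[simp] theorem c1_mk (a b : ℍ) : c1 (mk a b) = a := rfl
@[simp] theorem c2_mk (a b : ℍ) : c2 (mk a b) = b := rfl
@[simp] theorem c1_one : c1 1 = 1 := rfl
@[simp] theorem c2_one : c2 1 = 0 := rfl
@[simp] theorem c1_zero : c1 0 = 0 := rfl
@[simp] theorem c2_zero : c2 0 = 0 := rfl
@[simp] theorem c1_add (p q : Oct) : c1 (p + q) = c1 p + c1 q := rfl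
@[simp] theorem c2_add (p q : Oct) : c2 (p + q) = c2 p + c2 q := rfl
@[simp] theorem c1_neg (p : Oct) : c1 (-p) = -c1 p := rfl
@[simp] theorem c2_neg (p : Oct) : c2 (-p) = -c2 p := rfl
@[simp] theorem c1_smul (r : ℝ) (p : Oct) : c1 (r • p) = r • c1 p := rfl
@[simp] theorem c2_smul (r : ℝ) (p : Oct) : c2 (r • p) = r • c2 p := rfl
@[simp] theorem c1_mul (p q : Oct) : c1 (p * q) = c1 p * c1 q - star (c2 q) * c2 p := rfl
@[simp] theorem c2_mul (p q : Oct) : c2 (p * q) = c2 q * c1 p + c2 p * star (c1 q) := rfl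

/-- Left multiplication by an octonion. -/
def mulLeft (a : Oct) : Oct →L[ℝ] Oct :=
  LinearMap.toContinuousLinearMap
    { toFun := fun x => a * x
      map_add' := fun x y => by
        ext1
        · simp only [c1_mul, c1_add, c2_add, star_add, mul_add, add_mul]; abel
        · simp only [c2_mul, c1_add, c2_add, star_add, mul_add, add_mul]; abel
      map_smul' := fun r x => by
        ext1 <;> simp [smul_sub, smul_add] }

@[simp] theorem mulLeft_apply (a x : Oct) : mulLeft a x = a * x := rfl

theorem coords_of_mem_Sph {I : Oct} (hI : I ∈ Sph) :
    (c1 I).re = 0 ∧ (c1 I).imI ^ 2 + (c1 I).imJ ^ 2 + (c1 I).imK ^ 2 +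
      ((c2 I).re ^ 2 + (c2 I).imI ^ 2 + (c2 I).imJ ^ 2 + (c2 I).imK ^ 2) = 1 := by
  have h1 : c1 (I * I) = c1 (-1) := congrArg c1 hI
  have h2 : c2 (I * I) = c2 (-1) := congrArg c2 hI
  simp only [c1_mul, c2_mul, c1_neg, c2_neg, c1_one, c2_one, neg_zero, Quaternion.ext_iff] at h1 h2
  simp at h1 h2
  obtain ⟨a0, a1, a2, a3⟩ := h1
  obtain ⟨b0, b1, b2, b3⟩ := h2
  have hre : (c1 I).re = 0 := by
    by_contra hne
    have cancel {t : ℝ} (ht : (c1 I).re * t = 0) : t = 0 :=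
      (mul_eq_zero.1 ht).resolve_left hne
    have e0 : (c2 I).re = 0 := b0.resolve_right hne
    have e1 : (c2 I).imI = 0 := cancel (by linarith)
    have e2 : (c2 I).imJ = 0 := cancel (by linarith)
    have e3 : (c2 I).imK = 0 := cancel (by linarith)
    have f1 : (c1 I).imI = 0 := cancel (by linarith)
    have f2 : (c1 I).imJ = 0 := cancel (by linarith)
    have f3 : (c1 I).imK = 0 := cancel (by linarith)
    simp only [e0, e1, e2, e3, f1, f2, f3] at a0
    nlinarith [mul_self_nonneg (c1 I).re]
  rw [hre] at a0
  exact ⟨hre, by linarith⟩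

theorem c1_re_of_mem_Sph {I : Oct} (hI : I ∈ Sph) : (c1 I).re = 0 := (coords_of_mem_Sph hI).1

theorem ne_zero_of_mem_Sph {I : Oct} (hI : I ∈ Sph) : I ≠ 0 := by
  rintro rfl
  have h1 : c1 (0 * 0 : Oct) = c1 (-1) := congrArg c1 hI
  simp at h1

theorem mul_mul_self_of_mem_Sph {I : Oct} (hI : I ∈ Sph) (x : Oct) : I * (I * x) = -x := by
  obtain ⟨hre, hnorm⟩ := coords_of_mem_Sph hI
  ext1
  · ext <;> simp [hre]
    · linear_combination (-(c1 x).re) * hnorm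
    · linear_combination (-(c1 x).imI) * hnorm
    · linear_combination (-(c1 x).imJ) * hnorm
    · linear_combination (-(c1 x).imK) * hnorm
  · ext <;> simp [hre]
    · linear_combination (-(c2 x).re) * hnorm
    · linear_combination (-(c2 x).imI) * hnorm
    · linear_combination (-(c2 x).imJ) * hnorm
    · linear_combination (-(c2 x).imK) * hnorm

end Oct

theorem aff_zero {n : ℕ} (x : Fin n → ℝ) (I : Oct) : aff x 0 I = ofRealn x := by
  ext1 m
  simp [aff, ofRealn]

theorem aff_smul {n : ℕ} (x y : Fin n → ℝ) (c : ℝ) (I : Oct) :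
    aff x (c • y) I = aff x y (c • I) := by
  ext1 m
  simp only [aff, Pi.smul_apply, smul_eq_mul, smul_smul, mul_comm]

/-- Two slices meet only in real points, unless their units are proportional. -/
theorem aff_eq_aff {n : ℕ} {x y x' y' : Fin n → ℝ} {I J : Oct} (hI : I ∈ Sph) (hJ : J ∈ Sph)
    (h : aff x y I = aff x' y' J) :
    x = x' ∧ ((y = 0 ∧ y' = 0) ∨ ∃ c : ℝ, I = c • J ∧ y' = c • y) := by
  have hx : x = x' := by
    ext m
    have := congrArg (fun q => (c1 q).re) (congrFun h m)
    simpa [aff, c1_re_of_mem_Sph hI, c1_re_of_mem_Sph hJ] using this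
  subst hx
  have hy (m : Fin n) : y m • I = y' m • J := by
    simpa [aff] using congrFun h m
  refine ⟨rfl, ?_⟩
  by_cases h0 : y = 0
  · refine Or.inl ⟨h0, funext fun m => ?_⟩
    have := hy m
    rw [h0, Pi.zero_apply, zero_smul, eq_comm, smul_eq_zero] at this
    exact this.resolve_right (ne_zero_of_mem_Sph hJ)
  · obtain ⟨m, hm⟩ := Function.ne_iff.1 h0
    have hIJ : I = ((y m)⁻¹ * y' m) • J := by
      rw [mul_smul, ← hy m, inv_smul_smul₀ hm]
    refine Or.inr ⟨(y m)⁻¹ * y' m, hIJ, funext fun k => ?_⟩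
    have hk : (y k * ((y m)⁻¹ * y' m)) • J = y' k • J := by
      rw [mul_smul, ← hIJ, hy k]
    rw [← smul_left_injective ℝ (ne_zero_of_mem_Sph hJ) hk]
    simp [mul_comm]

theorem isOpen_τs_iff {n : ℕ} {U : Set (Fin n → Oct)} :
    IsOpen[τs n] U ↔
      ∀ I ∈ Sph, IsOpen {p : (Fin n → ℝ) × (Fin n → ℝ) | aff p.1 p.2 I ∈ U} := by
  unfold τs
  rw [isOpen_iSup_iff, Subtype.forall]
  rfl

theorem Holo.crOn_sub {n : ℕ} {I : Oct} (hI : I ∈ Sph)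
    {f g : (Fin n → ℝ) × (Fin n → ℝ) → Oct} {U : Set ((Fin n → ℝ) × (Fin n → ℝ))}
    (hU : IsOpen U) (hf : Holo n I f U) (hg : Holo n I g U) :
    CROn (mulLeft I) (fun p => f p - g p) U := by
  intro p hp
  have key {k : (Fin n → ℝ) × (Fin n → ℝ) → Oct} (hk : Holo n I k U) :
      HasFDerivAt k (fderiv ℝ k p) p ∧
        ∀ v, fderiv ℝ k p (0, v) = mulLeft I (fderiv ℝ k p (v, 0)) := by
    refine ⟨((hk.1.differentiableOn one_ne_zero).differentiableAt
      (hU.mem_nhds hp)).hasFDerivAt, fun v => ?_⟩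
    set D := fderiv ℝ k p
    have hlin : D.toLinearMap ∘ₗ LinearMap.inr ℝ (Fin n → ℝ) (Fin n → ℝ) =
        (mulLeft I).toLinearMap ∘ₗ D.toLinearMap ∘ₗ
          LinearMap.inl ℝ (Fin n → ℝ) (Fin n → ℝ) := by
      refine LinearMap.pi_ext' fun m => LinearMap.ext_ring ?_
      have hm : D (Pi.single m 1, 0) = -(I * D (0, Pi.single m 1)) :=
        eq_neg_of_add_eq_zero_left (hk.2 p hp m)
      have hneg : mulLeft I (-(I * D (0, Pi.single m 1))) = D (0, Pi.single m 1) := by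
        rw [map_neg, mulLeft_apply, mul_mul_self_of_mem_Sph hI, neg_neg]
      rw [← hm] at hneg
      exact hneg.symm
    exact LinearMap.congr_fun hlin v
  obtain ⟨hf1, hf2⟩ := key hf
  obtain ⟨hg1, hg2⟩ := key hg
  refine ⟨_, hf1.sub hg1, fun v => ?_⟩
  rw [sub_apply, sub_apply, hf2, hg2, map_sub]

/-- Identity principle on real-connected slice-domains: two
weak slice regular functions coinciding on a nonempty open subset of some
slice `Ω_I` (or of `Ω ∩ ℝⁿ`) coincide on all of `Ω`. -/
theorem identity_principle_realConnected (n : ℕ) (hn : 1 ≤ n)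
    (Ω : Set (Fin n → Oct)) (hΩ : SliceDomain n Ω) (hrc : RealConnected n Ω)
    (f g : (Fin n → Oct) → Oct) (hf : WSliceReg n Ω f) (hg : WSliceReg n Ω g)
    (hcoin :
      (∃ I ∈ Sph, ∃ A : Set ((Fin n → ℝ) × (Fin n → ℝ)), A.Nonempty ∧ IsOpen A ∧
        (∀ p ∈ A, aff p.1 p.2 I ∈ Ω) ∧
        ∀ p ∈ A, f (aff p.1 p.2 I) = g (aff p.1 p.2 I)) ∨
      (∃ A : Set (Fin n → ℝ), A.Nonempty ∧ IsOpen A ∧ (∀ x ∈ A, ofRealn x ∈ Ω) ∧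
        ∀ x ∈ A, f (ofRealn x) = g (ofRealn x))) :
    ∀ q ∈ Ω, f q = g q := by
  have hopen := isOpen_τs_iff.1 hΩ.1.2
  have hCR (I : Oct) (hI : I ∈ Sph) :
      CROn (mulLeft I) (fun p => f (aff p.1 p.2 I) - g (aff p.1 p.2 I))
        {p | aff p.1 p.2 I ∈ Ω} :=
    (hf I hI).crOn_sub hI (hopen I hI) (hg I hI)
  set Z : Set (Fin n → Oct) := {q | q ∈ Ω ∧ ∃ I ∈ Sph, ∃ p : (Fin n → ℝ) × (Fin n → ℝ),
    q = aff p.1 p.2 I ∧ ∀ᶠ p' in 𝓝 p, f (aff p'.1 p'.2 I) - g (aff p'.1 p'.2 I) = 0}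
  have hZ (I : Oct) (hI : I ∈ Sph) (p : (Fin n → ℝ) × (Fin n → ℝ)) :
      aff p.1 p.2 I ∈ Z ↔ aff p.1 p.2 I ∈ Ω ∧
        ∀ᶠ p' in 𝓝 p, f (aff p'.1 p'.2 I) - g (aff p'.1 p'.2 I) = 0 := by
    refine ⟨?_, fun h => ⟨h.1, I, hI, p, rfl, h.2⟩⟩
    rintro ⟨hpΩ, J, hJ, ⟨x', y'⟩, heq, hev⟩
    refine ⟨hpΩ, ?_⟩
    obtain ⟨x, y⟩ := p
    obtain ⟨hx, ⟨hy, hy'⟩ | ⟨c, hIJ, hy'⟩⟩ := aff_eq_aff hI hJ heq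
    · simp only at hx hy hy'
      subst hx hy hy'
      refine (hCR I hI).eventually_zero_of_real (mul_mul_self_of_mem_Sph hI) (hopen I hI)
        hpΩ ?_
      have ht : Tendsto (fun a : Fin n → ℝ => (a, (0 : Fin n → ℝ))) (𝓝 x) (𝓝 (x, 0)) :=
        Continuous.tendsto (by fun_prop) x
      filter_upwards [ht.eventually hev] with a ha
      simpa only [aff_zero] using ha
    · simp only at hx hy'
      subst hx hy'
      have ht : Tendsto (fun a : (Fin n → ℝ) × (Fin n → ℝ) => (a.1, c • a.2))
          (𝓝 (x, y)) (𝓝 (x, c • y)) :=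
        Continuous.tendsto (by fun_prop) (x, y)
      filter_upwards [ht.eventually hev] with a ha
      simpa only [aff_smul, ← hIJ] using ha
  have hZopen : IsOpen[τs n] Z := by
    refine isOpen_τs_iff.2 fun I hI => ?_
    simp only [hZ I hI]
    exact (hopen I hI).inter isOpen_setOfPred_eventually_nhds
  have hZcompl : IsOpen[τs n] (Ω \ Z) := by
    refine isOpen_τs_iff.2 fun I hI => ?_
    have := (hCR I hI).isOpen_not_eventually_zero (mul_mul_self_of_mem_Sph hI) (hopen I hI)
    convert this using 1
    ext p
    exact (and_congr_right fun hp => not_congr ((hZ I hI p).trans (and_iff_right hp)))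
  have hZne : (Ω ∩ Z).Nonempty := by
    rcases hcoin with ⟨I, hI, A, ⟨p, hp⟩, hA, hAΩ, hfg⟩ | ⟨A, ⟨x, hx⟩, hA, hAΩ, hfg⟩
    · refine ⟨aff p.1 p.2 I, hAΩ p hp, (hZ I hI p).2 ⟨hAΩ p hp, ?_⟩⟩
      filter_upwards [hA.mem_nhds hp] with a ha
      exact sub_eq_zero.2 (hfg a ha)
    · have hxΩ := hAΩ x hx
      obtain ⟨I, hI, -⟩ := Set.mem_iUnion₂.1 (hΩ.1.1 hxΩ)
      rw [← aff_zero x I] at hxΩ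
      refine ⟨aff x 0 I, hxΩ, (hZ I hI (x, 0)).2 ⟨hxΩ, ?_⟩⟩
      refine (hCR I hI).eventually_zero_of_real (mul_mul_self_of_mem_Sph hI) (hopen I hI)
        hxΩ ?_
      filter_upwards [hA.mem_nhds hx] with a ha
      simpa only [aff_zero] using sub_eq_zero.2 (hfg a ha)
  have hsub : Ω ⊆ Z := by
    let := τs n
    refine hΩ.2.isPreconnected.subset_left_of_subset_union hZopen hZcompl
      Set.disjoint_sdiff_right (fun q hq => ?_) hZne
    by_cases h : q ∈ Z
    · exact Or.inl h
    · exact Or.inr ⟨hq, h⟩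
  intro q hq
  obtain ⟨-, I, -, p, rfl, hev⟩ := hsub hq
  exact sub_eq_zero.1 hev.self_of_nhds

end
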